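/- Let A₁ : ℝ → ℝ^{m×ρ}, Q : ℝ → ℝ^{m×m}, R₁ : ℝ → ℝ^{ρ×ρ} be differentiable matrix-valued functions such that for every t: Q(t) is orthogonal (Q(t)ᵀ·Q(t) = 1ₘ), R₁(t) is upper triangular and invertible, and A₁(t) = Q₁(t)·R₁(t), where Q₁(t) denotes the first ρ columns of Q(t) and Q₂(t) the remaining m−ρ columns. Define K(t) := Q(t)ᵀ·A₁'(t)·R₁(t)⁻¹, with K₁(t) its top ρ×ρ block and K₂(t) its bottom (m−ρ)×ρ block. Then the derivative of Q₁ is recovered as Q₁'(t) = Q₁(t)·(sl(K₁(t)) − sl(K₁(t))ᵀ) + Q₂(t)·K₂(t), where sl(·) denotes the strictly lower triangular part of a matrix. -/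

import Mathlib

open Matrix

/-- The strictly lower triangular part of a square matrix. -/
def strictLower {p : ℕ} (A : Matrix (Fin p) (Fin p) ℝ) : Matrix (Fin p) (Fin p) ℝ :=
  Matrix.of fun i j => if j < i then A i j else 0

/-- The product rule for entrywise differentiable matrix-valued functions. -/
theorem hasDerivAt_matrix_mul_apply {l m n : Type*} [Fintype m]
    {A : ℝ → Matrix l m ℝ} {A' : Matrix l m ℝ} {B : ℝ → Matrix m n ℝ} {B' : Matrix m n ℝ} {t : ℝ}
    (hA : ∀ i j, HasDerivAt (fun u => A u i j) (A' i j) t)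
    (hB : ∀ i j, HasDerivAt (fun u => B u i j) (B' i j) t) (i : l) (j : n) :
    HasDerivAt (fun u => (A u * B u) i j) ((A' * B t + A t * B') i j) t := by
  simp only [Matrix.add_apply, Matrix.mul_apply, ← Finset.sum_add_distrib]
  exact HasDerivAt.fun_sum fun k _ => (hA i k).mul (hB k j)

/-- A skew-symmetric matrix is recovered from the strictly lower triangular part of its sum with
an upper triangular matrix. -/
theorem strictLower_add_sub_transpose {p : ℕ} {W T : Matrix (Fin p) (Fin p) ℝ}
    (hW : Wᵀ = -W) (hT : T.BlockTriangular id) :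
    strictLower (W + T) - (strictLower (W + T))ᵀ = W := by
  ext i j
  have hskew : ∀ a b, W b a = -W a b := fun a b => congrFun (congrFun hW a) b
  rcases lt_trichotomy i j with h | rfl | h
  · simp [strictLower, h, h.not_gt, hT h, hskew i j]
  · have := hskew i i
    simp only [strictLower, Matrix.sub_apply, Matrix.transpose_apply, Matrix.of_apply, lt_irrefl,
      if_false]
    linarith
  · simp [strictLower, h, h.not_gt, hT h]

/-- A product splits along a partition of the summation index into two consecutive blocks. -/
theorem mul_eq_castAdd_add_natAdd {l n : Type*} {p q : ℕ}
    (A : Matrix l (Fin (p + q)) ℝ) (B : Matrix (Fin (p + q)) n ℝ) :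
    A * B = A.submatrix id (Fin.castAdd q) * B.submatrix (Fin.castAdd q) id
      + A.submatrix id (Fin.natAdd p) * B.submatrix (Fin.natAdd p) id := by
  ext i j
  simp [Matrix.mul_apply, Fin.sum_univ_add]

/-- Differentiation of the QR factor: if `A₁(t) = Q₁(t)·R₁(t)` with
`Q(t) = [Q₁(t) Q₂(t)]` orthogonal and `R₁(t)` invertible upper triangular, then with
`K(t) = Q(t)ᵀ·A₁'(t)·R₁(t)⁻¹` (top block `K₁`, bottom block `K₂`) one recovers
`Q₁'(t) = Q₁(t)·(sl(K₁(t)) − sl(K₁(t))ᵀ) + Q₂(t)·K₂(t)`. Here `m = ρ + s` and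
derivatives are taken entrywise. -/
theorem qr_factor_derivative {ρ s : ℕ}
    (A₁ A₁' : ℝ → Matrix (Fin (ρ + s)) (Fin ρ) ℝ)
    (Q Q' : ℝ → Matrix (Fin (ρ + s)) (Fin (ρ + s)) ℝ)
    (R₁ R₁' : ℝ → Matrix (Fin ρ) (Fin ρ) ℝ)
    (hA : ∀ (t : ℝ) i j, HasDerivAt (fun u => A₁ u i j) (A₁' t i j) t)
    (hQ : ∀ (t : ℝ) i j, HasDerivAt (fun u => Q u i j) (Q' t i j) t)
    (hR : ∀ (t : ℝ) i j, HasDerivAt (fun u => R₁ u i j) (R₁' t i j) t)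
    (hQorth : ∀ t, (Q t)ᵀ * Q t = 1)
    (hRtri : ∀ (t : ℝ) (i j : Fin ρ), j < i → R₁ t i j = 0)
    (hRinv : ∀ t, IsUnit (R₁ t))
    (hQR : ∀ t, A₁ t = (Q t).submatrix id (Fin.castAdd s) * R₁ t)
    (K : ℝ → Matrix (Fin (ρ + s)) (Fin ρ) ℝ)
    (hK : ∀ t, K t = (Q t)ᵀ * A₁' t * (R₁ t)⁻¹)
    (K₁ : ℝ → Matrix (Fin ρ) (Fin ρ) ℝ)
    (hK₁ : ∀ t, K₁ t = (K t).submatrix (Fin.castAdd s) id)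
    (K₂ : ℝ → Matrix (Fin s) (Fin ρ) ℝ)
    (hK₂ : ∀ t, K₂ t = (K t).submatrix (Fin.natAdd ρ) id) :
    ∀ t, (Q' t).submatrix id (Fin.castAdd s) =
      (Q t).submatrix id (Fin.castAdd s) * (strictLower (K₁ t) - (strictLower (K₁ t))ᵀ)
        + (Q t).submatrix id (Fin.natAdd ρ) * K₂ t := by
  intro t
  set Q₁ := (Q t).submatrix id (Fin.castAdd s) with hQ₁
  set D := (Q' t).submatrix id (Fin.castAdd s) with hD
  have hA' : A₁' t = D * R₁ t + Q₁ * R₁' t := by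
    ext i j
    refine (hA t i j).unique ?_
    simp only [hQR]
    exact hasDerivAt_matrix_mul_apply (A := fun u => (Q u).submatrix id (Fin.castAdd s))
      (fun i j => hQ t i (Fin.castAdd s j)) (hR t) i j
  have hR' : (R₁' t).BlockTriangular id := fun i j hij =>
    (hR t i j).unique (by simpa only [hRtri _ i j hij] using hasDerivAt_const t (0 : ℝ))
  have hdet : IsUnit (R₁ t).det := (Matrix.isUnit_iff_isUnit_det _).1 (hRinv t)
  have hRi : ((R₁ t)⁻¹).BlockTriangular id := by
    have := (hRinv t).invertible
    exact Matrix.blockTriangular_inv_of_blockTriangular fun i j hij => hRtri t i j hij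
  have hKt : K t = (Q t)ᵀ * D + (Q t)ᵀ * Q₁ * (R₁' t * (R₁ t)⁻¹) := by
    rw [hK, hA', Matrix.mul_add, Matrix.add_mul, ← Matrix.mul_assoc, ← Matrix.mul_assoc,
      Matrix.mul_nonsing_inv_cancel_right _ _ hdet, Matrix.mul_assoc (_ * Q₁)]
  have hQQ₁ : (Q t)ᵀ * Q₁ = (1 : Matrix _ _ ℝ).submatrix id (Fin.castAdd s) := by
    rw [← hQorth t]; rfl
  have htop : K₁ t = Q₁ᵀ * D + R₁' t * (R₁ t)⁻¹ := by
    have h1 : ((Q t)ᵀ * Q₁).submatrix (Fin.castAdd s) id = 1 := by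
      ext i j
      simp [hQQ₁, Matrix.one_apply]
    calc K₁ t = Q₁ᵀ * D
          + ((Q t)ᵀ * Q₁).submatrix (Fin.castAdd s) id * (R₁' t * (R₁ t)⁻¹) := by
          rw [hK₁, hKt]; rfl
      _ = _ := by rw [h1, Matrix.one_mul]
  have hbot : K₂ t = ((Q t)ᵀ * D).submatrix (Fin.natAdd ρ) id := by
    have h0 : ((Q t)ᵀ * Q₁).submatrix (Fin.natAdd ρ) id = 0 := by
      ext i j
      have hne : Fin.natAdd ρ i ≠ Fin.castAdd s j := by
        simp only [ne_eq, Fin.ext_iff, Fin.val_natAdd, Fin.val_castAdd]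
        omega
      simp [hQQ₁, hne]
    calc K₂ t = ((Q t)ᵀ * D).submatrix (Fin.natAdd ρ) id
          + ((Q t)ᵀ * Q₁).submatrix (Fin.natAdd ρ) id * (R₁' t * (R₁ t)⁻¹) := by
          rw [hK₂, hKt]; rfl
      _ = _ := by rw [h0, Matrix.zero_mul, add_zero]
  have hskewQ : (Q' t)ᵀ * Q t + (Q t)ᵀ * Q' t = 0 := by
    ext i j
    have h := hasDerivAt_matrix_mul_apply (A := fun u => (Q u)ᵀ) (A' := (Q' t)ᵀ)
      (fun i j => hQ t j i) (hQ t) i j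
    simp only [hQorth] at h
    exact h.unique (hasDerivAt_const t _)
  have hskew : (Q₁ᵀ * D)ᵀ = -(Q₁ᵀ * D) := by
    rw [eq_neg_iff_add_eq_zero, Matrix.transpose_mul, Matrix.transpose_transpose]
    exact congrArg (fun M => M.submatrix (Fin.castAdd s) (Fin.castAdd s)) hskewQ
  rw [htop, strictLower_add_sub_transpose hskew (hR'.mul hRi), hbot]
  calc D = Q t * ((Q t)ᵀ * D) := by
        rw [← Matrix.mul_assoc, mul_eq_one_comm.1 (hQorth t), Matrix.one_mul]
    _ = _ := mul_eq_castAdd_add_natAdd _ _
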